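/- (Monotonicity of the non-deterministic EOB in sequence length) Let T ≥ 1 and let Σ be a real symmetric positive definite T×T matrix. Then the sequence k ↦ det R(Σ^{(k)}) for 1 ≤ k ≤ T is nonincreasing and bounded above by 1; equivalently, the non-deterministic EOB k ↦ −½ log det R(Σ^{(k)}) is nonnegative and nondecreasing in the sequence length k. -/

import Mathlib

open Matrix

/-- The correlation matrix: `R(Σ)_{ij} = Σ_{ij} / √(Σ_{ii} Σ_{jj})`. -/
noncomputable def corrMat {T : ℕ} (S : Matrix (Fin T) (Fin T) ℝ) :
    Matrix (Fin T) (Fin T) ℝ :=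
  fun i j => S i j / Real.sqrt (S i i * S j j)

/-- The `k×k` leading principal submatrix of a `T×T` matrix (0-based indices). -/
def lead {T : ℕ} (S : Matrix (Fin T) (Fin T) ℝ) (k : ℕ) (hk : k ≤ T) :
    Matrix (Fin k) (Fin k) ℝ :=
  S.submatrix (Fin.castLE hk) (Fin.castLE hk)

lemma step_aux {n : ℕ} (M : Matrix (Fin n ⊕ Fin 1) (Fin n ⊕ Fin 1) ℝ) (hM : M.PosDef)
    (h1 : M (Sum.inr 0) (Sum.inr 0) = 1) : M.det ≤ M.toBlocks₁₁.det := by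
  have hA : M.toBlocks₁₁.PosDef := hM.submatrix Sum.inl_injective
  have hC : M.toBlocks₂₁ = M.toBlocks₁₂ᴴ := by
    ext i j
    exact (hM.isHermitian.apply (Sum.inr i) (Sum.inl j)).symm
  have := hA.isUnit.invertible
  rw [← fromBlocks_toBlocks M, det_fromBlocks₁₁, fromBlocks_toBlocks, hC, det_fin_one,
    invOf_eq_nonsing_inv]
  have hq := (hA.inv.posSemidef.conjTranspose_mul_mul_same M.toBlocks₁₂).diag_nonneg (i := 0)
  have h2 : M.toBlocks₂₂ 0 0 = 1 := h1
  rw [Matrix.sub_apply, h2]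
  nlinarith [hA.det_pos]

lemma step_succ {n : ℕ} (M : Matrix (Fin (n+1)) (Fin (n+1)) ℝ) (hM : M.PosDef)
    (h1 : ∀ i, M i i = 1) : M.det ≤ (M.submatrix Fin.castSucc Fin.castSucc).det := by
  have := step_aux (M.submatrix finSumFinEquiv finSumFinEquiv)
    (hM.submatrix finSumFinEquiv.injective) (h1 _)
  rw [det_submatrix_equiv_self] at this
  exact this

lemma corr_posDef {T : ℕ} (S : Matrix (Fin T) (Fin T) ℝ) (hS : S.PosDef) :
    (corrMat S).PosDef := by
  have hd : ∀ i, 0 < S i i := fun i => hS.diag_pos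
  have e : corrMat S = (diagonal fun i => (Real.sqrt (S i i))⁻¹)ᴴ * S *
      (diagonal fun i => (Real.sqrt (S i i))⁻¹) := by
    ext i j
    rw [diagonal_conjTranspose, mul_diagonal, diagonal_mul, corrMat, Real.sqrt_mul (hd i).le]
    simp
    field_simp
  rw [e]
  refine hS.conjTranspose_mul_mul_same ?_
  apply mulVec_injective_of_isUnit
  rw [isUnit_iff_isUnit_det, det_diagonal, isUnit_iff_ne_zero, Finset.prod_ne_zero_iff]
  intro i _
  have := Real.sqrt_pos.2 (hd i)
  positivity

lemma lead_posDef {T : ℕ} (S : Matrix (Fin T) (Fin T) ℝ) (hS : S.PosDef) (k : ℕ) (hk : k ≤ T) :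
    (lead S k hk).PosDef := hS.submatrix (Fin.castLE_injective hk)

lemma corr_diag {T : ℕ} (S : Matrix (Fin T) (Fin T) ℝ) (hS : S.PosDef) (i : Fin T) :
    corrMat S i i = 1 := by
  have hd : 0 < S i i := hS.diag_pos
  rw [corrMat, Real.sqrt_mul_self hd.le, div_self hd.ne']

lemma mono_aux {T : ℕ} (S : Matrix (Fin T) (Fin T) ℝ) (hS : S.PosDef) (k l : ℕ) (hkl : k ≤ l) :
    ∀ hl : l ≤ T, (corrMat (lead S l hl)).det ≤ (corrMat (lead S k (hkl.trans hl))).det := by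
  induction l, hkl using Nat.le_induction with
  | base => intro hl; exact le_rfl
  | succ l hkl ih =>
    intro hl
    refine le_trans ?_ (ih ((Nat.le_succ l).trans hl))
    have hp := lead_posDef S hS (l+1) hl
    exact step_succ _ (corr_posDef _ hp) (corr_diag _ hp)

/-- Monotonicity of the non-deterministic EOB in sequence length: for positive definite
`Σ`, the sequence `k ↦ det R(Σ^{(k)})` (for `1 ≤ k ≤ T`) is nonincreasing and bounded
above by `1`; equivalently, `k ↦ −½ log det R(Σ^{(k)})` is nonnegative and
nondecreasing in `k`. -/
theorem EOB_monotone_in_length {T : ℕ} (hT : 1 ≤ T)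
    (S : Matrix (Fin T) (Fin T) ℝ) (hS : S.PosDef) :
    (∀ (k l : ℕ) (hk : 1 ≤ k) (hkl : k ≤ l) (hl : l ≤ T),
      (corrMat (lead S l hl)).det ≤ (corrMat (lead S k (hkl.trans hl))).det) ∧
    (∀ (k : ℕ) (hk : 1 ≤ k) (hkT : k ≤ T), (corrMat (lead S k hkT)).det ≤ 1) ∧
    (∀ (k l : ℕ) (hk : 1 ≤ k) (hkl : k ≤ l) (hl : l ≤ T),
      0 ≤ -(1 / 2 : ℝ) * Real.log (corrMat (lead S k (hkl.trans hl))).det ∧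
      -(1 / 2 : ℝ) * Real.log (corrMat (lead S k (hkl.trans hl))).det
        ≤ -(1 / 2 : ℝ) * Real.log (corrMat (lead S l hl)).det) := by
  have hone : ∀ (k : ℕ) (hkT : k ≤ T), (corrMat (lead S k hkT)).det ≤ 1 := by
    intro k hkT
    have := mono_aux S hS 0 k (Nat.zero_le k) hkT
    rwa [det_fin_zero] at this
  have hpos : ∀ (k : ℕ) (hkT : k ≤ T), 0 < (corrMat (lead S k hkT)).det :=
    fun k hkT => (corr_posDef _ (lead_posDef S hS k hkT)).det_pos
  refine ⟨fun k l _ hkl hl => mono_aux S hS k l hkl hl, fun k _ hkT => hone k hkT, ?_⟩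
  intro k l _ hkl hl
  have h1 := Real.log_nonpos (hpos k (hkl.trans hl)).le (hone k (hkl.trans hl))
  have h2 := Real.log_le_log (hpos l hl) (mono_aux S hS k l hkl hl)
  constructor <;> linarith
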